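/- Let f : [m,M] → ℝ be a convex function, let x₁,…,xₙ, y₁,…,yₙ ∈ [m,M], and let p₁,…,pₙ be positive real numbers with ∑_{i=1}^n pᵢ = 1. Suppose ∑_{i=1}^n pᵢ xᵢ = ∑_{i=1}^n pᵢ yᵢ. Then for any α ≥ 0 and any real β such that a_f t + b_f − α f(t) ≤ β for all t ∈ [m,M], one has ∑_{i=1}^n pᵢ f(yᵢ) ≤ β + α ∑_{i=1}^n pᵢ f(xᵢ). -/

import Mathlib

/-- A convex function on `[m, M]` lies below the chord through its endpoints. -/
theorem ConvexOn.le_chord {m M : ℝ} (hmM : m < M) {f : ℝ → ℝ}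
    (hf : ConvexOn ℝ (Set.Icc m M) f) {t : ℝ} (ht : t ∈ Set.Icc m M) :
    f t ≤ ((f M - f m) / (M - m)) * t + (M * f m - m * f M) / (M - m) := by
  have hd : 0 < M - m := sub_pos.2 hmM
  have h := hf.2 (Set.left_mem_Icc.2 hmM.le) (Set.right_mem_Icc.2 hmM.le)
    (div_nonneg (sub_nonneg.2 ht.2) hd.le) (div_nonneg (sub_nonneg.2 ht.1) hd.le)
    (by field_simp; ring)
  simp only [smul_eq_mul] at h
  have ht' : (M - t) / (M - m) * m + (t - m) / (M - m) * M = t := by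
    field_simp
    ring
  rw [ht'] at h
  refine h.trans_eq ?_
  field_simp
  ring

theorem stmt3 (m M : ℝ) (hmM : m < M) (f : ℝ → ℝ)
    (hconv : ConvexOn ℝ (Set.Icc m M) f)
    (n : ℕ) (x y : Fin n → ℝ)
    (hx : ∀ i, x i ∈ Set.Icc m M) (hy : ∀ i, y i ∈ Set.Icc m M)
    (p : Fin n → ℝ) (hp : ∀ i, 0 < p i) (hp1 : ∑ i, p i = 1)
    (heq : ∑ i, p i * x i = ∑ i, p i * y i)
    (α : ℝ) (hα : 0 ≤ α) (β : ℝ)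
    (hβ : ∀ t ∈ Set.Icc m M,
      ((f M - f m) / (M - m)) * t + (M * f m - m * f M) / (M - m) - α * f t ≤ β) :
    ∑ i, p i * f (y i) ≤ β + α * ∑ i, p i * f (x i) := by
  set a := (f M - f m) / (M - m)
  set b := (M * f m - m * f M) / (M - m)
  have sum_affine (z : Fin n → ℝ) : ∑ i, p i * (a * z i + b) = a * ∑ i, p i * z i + b := by
    simp only [mul_add, Finset.sum_add_distrib, ← Finset.sum_mul, hp1, one_mul, Finset.mul_sum,
      mul_left_comm]
  calc ∑ i, p i * f (y i) ≤ ∑ i, p i * (a * y i + b) :=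
        Finset.sum_le_sum fun i _ =>
          mul_le_mul_of_nonneg_left (hconv.le_chord hmM (hy i)) (hp i).le
    _ = ∑ i, p i * (a * x i + b) := by rw [sum_affine, sum_affine, heq]
    _ ≤ ∑ i, p i * (β + α * f (x i)) :=
        Finset.sum_le_sum fun i _ =>
          mul_le_mul_of_nonneg_left (by linarith [hβ (x i) (hx i)]) (hp i).le
    _ = β + α * ∑ i, p i * f (x i) := by
        simp only [mul_add, Finset.sum_add_distrib, ← Finset.sum_mul, hp1, one_mul,
          Finset.mul_sum, mul_left_comm]
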